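/- Let H be an infinite-dimensional separable complex Hilbert space, let p, q ∈ [1,∞] with 1/p + 1/q = 1, let C ∈ B^p(H) and T ∈ B^q(H). Then the closure of the C-numerical range W_C(T) is star-shaped with respect to the origin 0 ∈ ℂ. -/

import Mathlib

open Filter
open scoped InnerProductSpace ENNReal

/-- The rank-one operator `x ↦ ⟪f, x⟫ • g`. -/
noncomputable def rankOne {H : Type*} [NormedAddCommGroup H] [InnerProductSpace ℂ H]
    (f g : H) : H →L[ℂ] H :=
  (innerSL ℂ f).smulRight g

/-- The `n`-th singular value (`0`-indexed) of an operator, defined as its distance (in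
operator norm) to the operators of rank at most `n`; for compact operators this coincides with
the `(n+1)`-st coefficient of a Schmidt decomposition. -/
noncomputable def sv {H : Type*} [NormedAddCommGroup H] [InnerProductSpace ℂ H]
    (T : H →L[ℂ] H) (n : ℕ) : ℝ :=
  ⨅ (u : Fin n → H) (v : Fin n → H), ‖T - ∑ i, rankOne (u i) (v i)‖

/-- Membership in the `p`-th Schatten class `B^p(H)`, `p ∈ [1,∞]`:  compact and, if `p ≠ ∞`,
`p`-summable singular values. -/
def MemSchatten {H : Type*} [NormedAddCommGroup H] [InnerProductSpace ℂ H]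
    (p : ℝ≥0∞) (T : H →L[ℂ] H) : Prop :=
  IsCompactOperator T ∧ (p ≠ ∞ → Summable fun n => sv T n ^ p.toReal)

/-- The Schatten `p`-norm `ν_p`. -/
noncomputable def schattenNorm {H : Type*} [NormedAddCommGroup H] [InnerProductSpace ℂ H]
    (p : ℝ≥0∞) (T : H →L[ℂ] H) : ℝ :=
  if p = ∞ then ‖T‖ else (∑' n, sv T n ^ p.toReal) ^ (1 / p.toReal)

/-- The trace of an operator computed along the orthonormal basis `b`; for trace-class
operators this is basis-independent. -/
noncomputable def traceAlong {H : Type*} [NormedAddCommGroup H] [InnerProductSpace ℂ H]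
    [CompleteSpace H] (b : HilbertBasis ℕ ℂ H) (A : H →L[ℂ] H) : ℂ :=
  ∑' i, ⟪(b i : H), A (b i)⟫_ℂ

/-- The `C`-numerical range `W_C(T) = { tr(C U† T U) | U unitary }`. -/
def cNumRange {H : Type*} [NormedAddCommGroup H] [InnerProductSpace ℂ H]
    [CompleteSpace H] (b : HilbertBasis ℕ ℂ H) (C T : H →L[ℂ] H) : Set ℂ :=
  {z | ∃ U ∈ unitary (H →L[ℂ] H), z = traceAlong b (C * star U * T * U)}

 

set_option linter.unusedSectionVars false

section helpers
variable {H : Type*} [NormedAddCommGroup H] [InnerProductSpace ℂ H]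

/-- rank at most `n` -/
def FR (n : ℕ) (F : H →L[ℂ] H) : Prop :=
  LinearMap.rank (F : H →ₗ[ℂ] H) ≤ (n : Cardinal)

lemma FR.add {m n : ℕ} {F G : H →L[ℂ] H} (hF : FR m F) (hG : FR n G) : FR (m + n) (F + G) := by
  unfold FR at *
  rw [ContinuousLinearMap.toLinearMap_add]
  push_cast
  exact (LinearMap.rank_add_le _ _).trans (add_le_add hF hG)

lemma FR.mul_right {m : ℕ} {F : H →L[ℂ] H} (hF : FR m F) (G : H →L[ℂ] H) : FR m (F * G) :=
  (LinearMap.rank_comp_le_left (G : H →ₗ[ℂ] H) (F : H →ₗ[ℂ] H)).trans hF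

lemma FR.mul_left {m : ℕ} {F : H →L[ℂ] H} (hF : FR m F) (G : H →L[ℂ] H) : FR m (G * F) :=
  (LinearMap.rank_comp_le_right (F : H →ₗ[ℂ] H) (G : H →ₗ[ℂ] H)).trans hF

lemma FR.neg {m : ℕ} {F : H →L[ℂ] H} (hF : FR m F) : FR m (-F) := by
  simpa using hF.mul_left (-1)

lemma FR.sub {m n : ℕ} {F G : H →L[ℂ] H} (hF : FR m F) (hG : FR n G) : FR (m + n) (F - G) := by
  rw [sub_eq_add_neg]; exact hF.add hG.neg

lemma FR.mono {m n : ℕ} {F : H →L[ℂ] H} (hF : FR m F) (h : m ≤ n) : FR n F :=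
  le_trans hF (by exact_mod_cast h)

lemma FR.zero (n : ℕ) : FR n (0 : H →L[ℂ] H) := by
  unfold FR
  rw [ContinuousLinearMap.toLinearMap_zero, LinearMap.rank_zero]
  exact bot_le

lemma rankOne_apply (f g x : H) : rankOne f g x = ⟪f, x⟫_ℂ • g := rfl

lemma FR.rankOne (f g : H) : FR 1 (rankOne f g) := by
  have h : LinearMap.range ((_root_.rankOne f g : H →L[ℂ] H) : H →ₗ[ℂ] H)
      ≤ Submodule.span ℂ {g} := by
    rintro _ ⟨x, rfl⟩
    exact Submodule.smul_mem _ _ (Submodule.mem_span_singleton_self g)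
  have h2 := (Submodule.rank_mono h).trans (rank_span_le (R := ℂ) {g})
  simpa [FR, LinearMap.rank] using h2

lemma FR.sum {n : ℕ} (u v : Fin n → H) : FR n (∑ i, _root_.rankOne (u i) (v i)) := by
  induction n with
  | zero => simpa using FR.zero 0
  | succ k ih =>
    rw [Fin.sum_univ_castSucc]
    exact (ih _ _).add (FR.rankOne _ _)

lemma FR.exists {n : ℕ} {F : H →L[ℂ] H} (hF : FR n F) :
    ∃ g : Fin n → H, (∀ i, ‖g i‖ ≤ 1) ∧ ∀ x, F x = ∑ i, ⟪g i, F x⟫_ℂ • g i := by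
  have hlt : Module.rank ℂ (LinearMap.range (F : H →ₗ[ℂ] H)) < Cardinal.aleph0 :=
    lt_of_le_of_lt hF (Cardinal.natCast_lt_aleph0)
  have : FiniteDimensional ℂ (LinearMap.range (F : H →ₗ[ℂ] H)) :=
    Module.rank_lt_aleph0_iff.1 hlt
  have hd : Module.finrank ℂ (LinearMap.range (F : H →ₗ[ℂ] H)) ≤ n :=
    Module.finrank_le_of_rank_le hF
  set K := LinearMap.range (F : H →ₗ[ℂ] H)
  let e := stdOrthonormalBasis ℂ K
  have hinj := Fin.castLE_injective hd
  let g : Fin n → H := Function.extend (Fin.castLE hd) (fun i => (e i : H)) 0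
  have hg : ∀ i, g (Fin.castLE hd i) = (e i : H) := fun i => hinj.extend_apply _ _ i
  have hg0 : ∀ i, i ∉ Set.range (Fin.castLE hd) → g i = 0 := fun i hi => by
    simp only [g]; rw [Function.extend_apply' _ _ _ (by rintro ⟨j, rfl⟩; exact hi ⟨j, rfl⟩)]; rfl
  refine ⟨g, fun i => ?_, fun x => ?_⟩
  · by_cases hi : i ∈ Set.range (Fin.castLE hd)
    · obtain ⟨j, rfl⟩ := hi
      rw [hg]
      have := e.orthonormal.1 j
      exact this.le
    · rw [hg0 i hi]; simp
  · have h1 := e.sum_repr' (⟨F x, ⟨x, rfl⟩⟩ : K)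
    have h2 := congrArg (fun y : K => (y : H)) h1
    simp only [Submodule.coe_sum, Submodule.coe_smul, Submodule.coe_inner] at h2
    rw [← Fintype.sum_of_injective (Fin.castLE hd) hinj
      (fun i => ⟪(e i : H), F x⟫_ℂ • (e i : H))]
    · exact h2.symm
    · intro i hi; rw [hg0 i hi]; simp
    · intro i; simp only [hg]

variable [CompleteSpace H]

lemma FR.exists' {n : ℕ} {F : H →L[ℂ] H} (hF : FR n F) :
    ∃ u v : Fin n → H, F = ∑ i, _root_.rankOne (u i) (v i) := by
  obtain ⟨g, -, hg⟩ := hF.exists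
  refine ⟨fun i => ContinuousLinearMap.adjoint F (g i), g, ?_⟩
  ext x
  rw [hg x]
  simp [rankOne_apply, ContinuousLinearMap.adjoint_inner_left]

lemma sv_bdd (T : H →L[ℂ] H) (n : ℕ) (u : Fin n → H) :
    BddBelow (Set.range fun v : Fin n → H => ‖T - ∑ i, rankOne (u i) (v i)‖) :=
  ⟨0, by rintro _ ⟨v, rfl⟩; positivity⟩

lemma sv_le {T F : H →L[ℂ] H} {n : ℕ} (hF : FR n F) : sv T n ≤ ‖T - F‖ := by
  obtain ⟨u, v, rfl⟩ := hF.exists'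
  refine (ciInf_le ⟨0, ?_⟩ u).trans (ciInf_le (sv_bdd T n u) v)
  rintro _ ⟨u, rfl⟩
  exact Real.iInf_nonneg fun v => by positivity

lemma sv_nonneg (T : H →L[ℂ] H) (n : ℕ) : 0 ≤ sv T n :=
  Real.iInf_nonneg fun _ => Real.iInf_nonneg fun v => by positivity

lemma sv_approx (T : H →L[ℂ] H) (n : ℕ) {ε : ℝ} (hε : 0 < ε) :
    ∃ F, FR n F ∧ ‖T - F‖ < sv T n + ε := by
  obtain ⟨u, hu⟩ := exists_lt_of_ciInf_lt (show sv T n < sv T n + ε by linarith)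
  obtain ⟨v, hv⟩ := exists_lt_of_ciInf_lt hu
  exact ⟨_, FR.sum u v, hv⟩

lemma sv_anti (T : H →L[ℂ] H) : Antitone (sv T) := by
  intro m n h
  refine le_of_forall_pos_le_add fun ε hε => ?_
  obtain ⟨F, hF, h2⟩ := sv_approx T m hε
  exact (sv_le (hF.mono h)).trans h2.le

lemma sv_le_norm (T : H →L[ℂ] H) (n : ℕ) : sv T n ≤ ‖T‖ := by
  simpa using sv_le (T := T) (FR.zero n)

lemma norm_le_sv (T : H →L[ℂ] H) : ‖T‖ ≤ sv T 0 := by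
  refine le_of_forall_pos_le_add fun ε hε => ?_
  obtain ⟨F, hF, h2⟩ := sv_approx T 0 hε
  obtain ⟨u, v, rfl⟩ := hF.exists'
  simpa using h2.le

lemma sv_mul (X Y : H →L[ℂ] H) (m n : ℕ) : sv (X * Y) (m + n) ≤ sv X m * sv Y n := by
  have key : ∀ ε : ℝ, 0 < ε → sv (X * Y) (m + n) ≤ (sv X m + ε) * (sv Y n + ε) := by
    intro ε hε
    obtain ⟨F, hF, h1⟩ := sv_approx X m hε
    obtain ⟨G, hG, h2⟩ := sv_approx Y n hε
    have h3 : sv (X * Y) (m + n) ≤ ‖X * Y - (F * Y + (X - F) * G)‖ :=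
      sv_le ((hF.mul_right Y).add (hG.mul_left _))
    have h4 : X * Y - (F * Y + (X - F) * G) = (X - F) * (Y - G) := by noncomm_ring
    rw [h4] at h3
    refine h3.trans ((norm_mul_le _ _).trans ?_)
    have := sv_nonneg X m
    gcongr
  have hc : Tendsto (fun ε : ℝ => (sv X m + ε) * (sv Y n + ε)) (nhdsWithin 0 (Set.Ioi 0))
      (nhds ((sv X m + 0) * (sv Y n + 0))) := by
    refine tendsto_nhdsWithin_of_tendsto_nhds ?_
    exact Continuous.tendsto (by fun_prop) 0
  simp only [add_zero] at hc
  refine ge_of_tendsto hc ?_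
  filter_upwards [self_mem_nhdsWithin] with ε hε using key ε hε

lemma sv_contr (A X B : H →L[ℂ] H) (hA : ‖A‖ ≤ 1) (hB : ‖B‖ ≤ 1) (n : ℕ) :
    sv (A * X * B) n ≤ sv X n := by
  have h1 := sv_mul A X 0 n
  have h2 := sv_mul (A * X) B n 0
  have h3 := sv_le_norm A 0
  have h4 := sv_le_norm B 0
  simp only [zero_add, add_zero] at h1 h2
  have := sv_nonneg X n
  have := sv_nonneg A 0
  have := sv_nonneg B 0
  have := sv_nonneg (A * X) n
  nlinarith

lemma sv_sub (X F : H →L[ℂ] H) (m n : ℕ) (hF : FR n F) : sv (X - F) (m + n) ≤ sv X m := by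
  refine le_of_forall_pos_le_add fun ε hε => ?_
  obtain ⟨G, hG, h2⟩ := sv_approx X m hε
  refine (sv_le (hG.sub hF)).trans ?_
  have : X - F - (G - F) = X - G := by abel
  rw [this]; exact h2.le


lemma diag_FR {ι : Type*} {b : ι → H} (hb : Orthonormal ℂ b) {r : ℕ} {D : H →L[ℂ] H} (hD : FR r D)
    (s : Finset ι) : ∑ i ∈ s, ‖⟪b i, D (b i)⟫_ℂ‖ ≤ r * ‖D‖ := by
  obtain ⟨g, hg1, hg⟩ := hD.exists
  have hB : ∀ x : H, ∑ i ∈ s, ‖⟪b i, x⟫_ℂ‖ ^ 2 ≤ ‖x‖ ^ 2 := fun x => hb.sum_inner_products_le x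
  have h1 : ∀ i, ‖⟪b i, D (b i)⟫_ℂ‖ ≤
      ∑ j, ‖⟪b i, ContinuousLinearMap.adjoint D (g j)⟫_ℂ‖ * ‖⟪b i, g j⟫_ℂ‖ := by
    intro i
    rw [hg (b i), inner_sum]
    refine (norm_sum_le _ _).trans (Finset.sum_le_sum fun j _ => ?_)
    rw [inner_smul_right, norm_mul, ContinuousLinearMap.adjoint_inner_right, norm_inner_symm]
  calc ∑ i ∈ s, ‖⟪b i, D (b i)⟫_ℂ‖
      ≤ ∑ i ∈ s, ∑ j, ‖⟪b i, ContinuousLinearMap.adjoint D (g j)⟫_ℂ‖ * ‖⟪b i, g j⟫_ℂ‖ :=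
        Finset.sum_le_sum fun i _ => h1 i
    _ = ∑ j, ∑ i ∈ s, ‖⟪b i, ContinuousLinearMap.adjoint D (g j)⟫_ℂ‖ * ‖⟪b i, g j⟫_ℂ‖ :=
        Finset.sum_comm
    _ ≤ ∑ j : Fin r, ‖D‖ := by
        refine Finset.sum_le_sum fun j _ => ?_
        have hcs := Finset.sum_mul_sq_le_sq_mul_sq s
          (fun i => ‖⟪b i, ContinuousLinearMap.adjoint D (g j)⟫_ℂ‖) (fun i => ‖⟪b i, g j⟫_ℂ‖)
        have hn : ‖ContinuousLinearMap.adjoint D (g j)‖ ≤ ‖D‖ := by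
          refine (ContinuousLinearMap.le_opNorm _ _).trans ?_
          rw [LinearIsometryEquiv.norm_map]
          exact mul_le_of_le_one_right (norm_nonneg _) (hg1 j)
        refine le_of_sq_le_sq (hcs.trans ?_) (norm_nonneg _)
        have e1 : ∑ i ∈ s, ‖⟪b i, ContinuousLinearMap.adjoint D (g j)⟫_ℂ‖ ^ 2 ≤ ‖D‖ ^ 2 :=
          (hB _).trans (by gcongr)
        have e2 : ∑ i ∈ s, ‖⟪b i, g j⟫_ℂ‖ ^ 2 ≤ 1 :=
          (hB _).trans (pow_le_one₀ (norm_nonneg _) (hg1 j))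
        calc _ ≤ ‖D‖ ^ 2 * 1 := mul_le_mul e1 e2 (Finset.sum_nonneg fun i _ => by positivity)
                (by positivity)
          _ = _ := mul_one _
    _ = r * ‖D‖ := by simp

lemma diag_add {ι : Type*} (b : ι → H) (s : Finset ι) (A B : H →L[ℂ] H) :
    ∑ i ∈ s, ‖⟪b i, (A + B) (b i)⟫_ℂ‖ ≤
      ∑ i ∈ s, ‖⟪b i, A (b i)⟫_ℂ‖ + ∑ i ∈ s, ‖⟪b i, B (b i)⟫_ℂ‖ := by
  rw [← Finset.sum_add_distrib]
  refine Finset.sum_le_sum fun i _ => ?_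
  rw [add_apply, inner_add_right]
  exact norm_add_le _ _

lemma diag_norm {ι : Type*} {b : ι → H} (hb : Orthonormal ℂ b) (s : Finset ι) (A : H →L[ℂ] H) :
    ∑ i ∈ s, ‖⟪b i, A (b i)⟫_ℂ‖ ≤ s.card * ‖A‖ := by
  rw [← nsmul_eq_mul]
  refine Finset.sum_le_card_nsmul _ _ _ fun i _ => ?_
  refine (norm_inner_le_norm _ _).trans ?_
  have := A.le_opNorm (b i)
  rw [hb.1 i] at *
  simpa using this

lemma diag_dyadic {ι : Type*} {b : ι → H} (hb : Orthonormal ℂ b) (s : Finset ι) (X : H →L[ℂ] H)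
    (N : ℕ) (ε : ℝ) (hε : 0 < ε) : ∑ i ∈ s, ‖⟪b i, X (b i)⟫_ℂ‖ ≤
      s.card * (sv X (2 ^ N) + ε) + (2 * sv X 0 + ε) +
        ∑ k ∈ Finset.range N, 3 * 2 ^ k * (2 * sv X (2 ^ k) + 2 * ε) := by
  choose F hF hFn using fun k : ℕ => sv_approx X (2 ^ k) hε
  have h0 : ∀ n, ∑ i ∈ s, ‖⟪b i, F n (b i)⟫_ℂ‖ ≤ (2 * sv X 0 + ε) +
        ∑ k ∈ Finset.range n, 3 * 2 ^ k * (2 * sv X (2 ^ k) + 2 * ε) := by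
    intro n
    induction n with
    | zero =>
      have h1 := diag_FR hb (hF 0) s
      have h2 : ‖F 0‖ ≤ ‖X‖ + ‖X - F 0‖ := by
        have := norm_sub_le X (X - F 0)
        simpa using this
      have h3 := hFn 0
      have h4 := norm_le_sv X
      have h5 := sv_anti X (Nat.zero_le (2 ^ 0))
      simp only [pow_zero, Nat.cast_one, one_mul, Finset.range_zero, Finset.sum_empty] at *
      linarith
    | succ n ih =>
      have h1 := diag_add b s (F n) (F (n + 1) - F n)
      rw [add_sub_cancel] at h1
      have h2 := diag_FR hb ((hF (n + 1)).sub (hF n)) s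
      have h3 : ‖F (n + 1) - F n‖ ≤ 2 * sv X (2 ^ n) + 2 * ε := by
        have e : F (n + 1) - F n = (X - F n) - (X - F (n + 1)) := by abel
        rw [e]
        have e1 := norm_sub_le (X - F n) (X - F (n + 1))
        have e2 := sv_anti X (show 2 ^ n ≤ 2 ^ (n + 1) from Nat.pow_le_pow_right (by norm_num) (by omega))
        have e3 := hFn n
        have e4 := hFn (n + 1)
        linarith
      have h4 : (((2 ^ (n + 1) + 2 ^ n : ℕ)) : ℝ) = 3 * 2 ^ n := by push_cast; ring
      rw [h4] at h2
      rw [Finset.sum_range_succ]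
      have h5 : (3 : ℝ) * 2 ^ n * ‖F (n + 1) - F n‖ ≤ 3 * 2 ^ n * (2 * sv X (2 ^ n) + 2 * ε) := by
        gcongr
      linarith
  have h1 := diag_add b s (X - F N) (F N)
  rw [sub_add_cancel] at h1
  have h2 := diag_norm hb s (X - F N)
  have h3 : (s.card : ℝ) * ‖X - F N‖ ≤ s.card * (sv X (2 ^ N) + ε) := by
    gcongr; exact (hFn N).le
  have := h0 N
  linarith

lemma diag_le {ι : Type*} {b : ι → H} (hb : Orthonormal ℂ b) (s : Finset ι) (X : H →L[ℂ] H)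
    (hX : Summable (sv X)) :
    ∑ i ∈ s, ‖⟪b i, X (b i)⟫_ℂ‖ ≤ 12 * ∑' n, sv X n := by
  have h1 : ∀ N : ℕ, ∑ i ∈ s, ‖⟪b i, X (b i)⟫_ℂ‖ ≤
      s.card * sv X (2 ^ N) + 12 * ∑' n, sv X n := by
    intro N
    have hc : Tendsto (fun ε : ℝ => s.card * (sv X (2 ^ N) + ε) + (2 * sv X 0 + ε) +
        ∑ k ∈ Finset.range N, 3 * 2 ^ k * (2 * sv X (2 ^ k) + 2 * ε))
        (nhdsWithin 0 (Set.Ioi 0))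
        (nhds (s.card * (sv X (2 ^ N) + 0) + (2 * sv X 0 + 0) +
        ∑ k ∈ Finset.range N, 3 * 2 ^ k * (2 * sv X (2 ^ k) + 2 * 0))) := by
      refine tendsto_nhdsWithin_of_tendsto_nhds ?_
      exact Continuous.tendsto (by fun_prop) 0
    have h2 := ge_of_tendsto hc (b := ∑ i ∈ s, ‖⟪b i, X (b i)⟫_ℂ‖) (by
      filter_upwards [self_mem_nhdsWithin] with ε hε using diag_dyadic hb s X N ε hε)
    simp only [add_zero, mul_zero] at h2
    have h3 : ∑ k ∈ Finset.range N, 3 * 2 ^ k * (2 * sv X (2 ^ k))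
        = 6 * ∑ k ∈ Finset.range N, 2 ^ k • sv X (2 ^ k) := by
      rw [Finset.mul_sum]
      refine Finset.sum_congr rfl fun k _ => ?_
      rw [nsmul_eq_mul]; push_cast; ring
    have h4 : ∑ k ∈ Finset.range N, 2 ^ k • sv X (2 ^ k) ≤
        ∑ k ∈ Finset.range (N + 1), 2 ^ k • sv X (2 ^ k) := by
      refine Finset.sum_le_sum_of_subset_of_nonneg (Finset.range_mono (by omega)) fun i _ _ => ?_
      have := sv_nonneg X (2 ^ i)
      positivity
    have h5 := Finset.sum_condensed_le (f := sv X) (fun m n _ h => sv_anti X h) N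
    have h6 : sv X 0 + sv X 1 + ∑ k ∈ Finset.Ico 2 (2 ^ N + 1), sv X k ≤ ∑' n, sv X n := by
      have := hX.sum_le_tsum ({0, 1} ∪ Finset.Ico 2 (2 ^ N + 1)) (fun i _ => sv_nonneg X i)
      rw [Finset.sum_union] at this
      · simpa using this
      · rw [Finset.disjoint_left]; intro a; simp; omega
    have := sv_nonneg X 0
    have := sv_nonneg X 1
    rw [two_nsmul] at h5
    linarith
  have h2 : Tendsto (fun N : ℕ => s.card * sv X (2 ^ N) + 12 * ∑' n, sv X n) atTop
      (nhds (s.card * 0 + 12 * ∑' n, sv X n)) := by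
    refine Tendsto.add_const _ (Tendsto.const_mul _ ?_)
    exact hX.tendsto_atTop_zero.comp (tendsto_pow_atTop_atTop_of_one_lt (by norm_num))
  simpa using ge_of_tendsto' h2 h1

lemma diag_summable {ι : Type*} {b : ι → H} (hb : Orthonormal ℂ b) (X : H →L[ℂ] H) (f : ℕ → ℝ)
    (hf : Summable f) (h : ∀ n, sv X n ≤ f n) :
    Summable (fun i => ⟪b i, X (b i)⟫_ℂ) ∧ ‖∑' i, ⟪b i, X (b i)⟫_ℂ‖ ≤ 12 * ∑' n, f n := by
  have hX : Summable (sv X) := Summable.of_nonneg_of_le (sv_nonneg X) h hf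
  have h1 : ∑' n, sv X n ≤ ∑' n, f n := hX.tsum_le_tsum h hf
  have h2 : ∀ s : Finset ι, ∑ i ∈ s, ‖⟪b i, X (b i)⟫_ℂ‖ ≤ 12 * ∑' n, f n := fun s =>
    (diag_le hb s X hX).trans (by linarith)
  have h3 : Summable (fun i => ‖⟪b i, X (b i)⟫_ℂ‖) :=
    summable_of_sum_le (fun i => norm_nonneg _) h2
  exact ⟨h3.of_norm, (norm_tsum_le_tsum_norm h3).trans (h3.tsum_le_of_sum_le h2)⟩

lemma summable_div {h : ℕ → ℝ} (h0 : ∀ n, 0 ≤ h n) (hs : Summable h) (k : ℕ) (hk : 0 < k) :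
    Summable (fun n => h (n / k)) := by
  have h1 : ∀ N, ∑ n ∈ Finset.range (k * N), h (n / k) = k * ∑ n ∈ Finset.range N, h n := by
    intro N
    induction N with
    | zero => simp
    | succ N ih =>
      rw [Nat.mul_succ, Finset.sum_range_add, ih, Finset.sum_range_succ, mul_add]
      congr 1
      rw [Finset.sum_congr rfl (g := fun _ => h N)]
      · simp
      · intro x hx
        rw [Nat.mul_add_div hk, Nat.div_eq_of_lt (Finset.mem_range.1 hx), add_zero]
  refine summable_of_sum_range_le (c := k * ∑' n, h n) (fun n => h0 _) fun N => ?_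
  calc ∑ n ∈ Finset.range N, h (n / k) ≤ ∑ n ∈ Finset.range (k * N), h (n / k) :=
        Finset.sum_le_sum_of_subset_of_nonneg (Finset.range_mono (Nat.le_mul_of_pos_left N hk))
          (fun i _ _ => h0 _)
    _ = _ := h1 N
    _ ≤ _ := by
      gcongr
      exact hs.sum_le_tsum _ (fun i _ => h0 i)

lemma sv_compact {T : H →L[ℂ] H} (hT : IsCompactOperator T) :
    Tendsto (sv T) atTop (nhds 0) := by
  rw [Metric.tendsto_atTop]
  intro ε hε
  have hc := hT.isCompact_closure_image_closedBall (𝕜₁ := ℂ) (f := (T : H →ₗ[ℂ] H)) 1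
  obtain ⟨t, -, htf, ht⟩ := hc.finite_cover_balls (half_pos hε)
  have : FiniteDimensional ℂ (Submodule.span ℂ t) := FiniteDimensional.span_of_finite ℂ htf
  set K := Submodule.span ℂ t
  have hr : FR (Module.finrank ℂ K) (K.starProjection * T) := by
    refine FR.mul_right ?_ T
    unfold FR
    rw [Module.finrank_eq_rank]
    refine Submodule.rank_mono ?_
    rintro _ ⟨x, rfl⟩
    simp
  have hn : ‖T - K.starProjection * T‖ ≤ ε / 2 := by
    refine ContinuousLinearMap.opNorm_le_of_unit_norm (𝕜 := ℂ) (by positivity) fun x hx => ?_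
    have hm : T x ∈ closure ((T : H →ₗ[ℂ] H) '' Metric.closedBall 0 1) :=
      subset_closure ⟨x, by simp [hx], rfl⟩
    obtain ⟨y, hy, hxy⟩ := Set.mem_iUnion₂.1 (ht hm)
    have h1 : ‖T x - K.starProjection (T x)‖ ≤ ‖T x - y‖ := by
      rw [Submodule.starProjection_minimal]
      exact ciInf_le ⟨0, by rintro _ ⟨z, rfl⟩; positivity⟩ (⟨y, Submodule.subset_span hy⟩ : K)
    have h2 : ‖T x - y‖ < ε / 2 := by simpa [dist_eq_norm] using hxy
    exact h1.trans h2.le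
  refine ⟨Module.finrank ℂ K, fun n hn' => ?_⟩
  rw [Real.dist_eq, sub_zero, abs_of_nonneg (sv_nonneg T n)]
  have := sv_le (T := T) (hr.mono hn')
  linarith

lemma trace_FR (b : HilbertBasis ℕ ℂ H) {n : ℕ} (u v : Fin n → H) (A : H →L[ℂ] H) :
    HasSum (fun i => ⟪b i, ((∑ j, rankOne (u j) (v j)) * A) (b i)⟫_ℂ) (∑ j, ⟪u j, A (v j)⟫_ℂ) := by
  have h1 : ∀ j, HasSum (fun i => ⟪u j, A (b i)⟫_ℂ * ⟪b i, v j⟫_ℂ) ⟪u j, A (v j)⟫_ℂ := by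
    intro j
    have := b.hasSum_inner_mul_inner (ContinuousLinearMap.adjoint A (u j)) (v j)
    simpa only [ContinuousLinearMap.adjoint_inner_left] using this
  have h2 := hasSum_sum (s := Finset.univ) (fun j _ => h1 j)
  convert h2 using 2 with i
  simp [rankOne_apply, inner_sum, inner_smul_right, sum_apply]

lemma sv_prod_le (X A : H →L[ℂ] H) (n : ℕ) : sv (X * A) n ≤ sv X (n / 2) * sv A (n / 2) :=
  (sv_anti _ (by omega)).trans (sv_mul X A (n / 2) (n / 2))

lemma trace_tendsto (b : HilbertBasis ℕ ℂ H) (C : H →L[ℂ] H) (τ : ℕ → ℝ) (hτ : Antitone τ)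
    (hs : Summable fun n => sv C n * τ n) (hC : Tendsto (sv C) atTop (nhds 0))
    (A : ℕ → H →L[ℂ] H) (B : H →L[ℂ] H) (hA : ∀ n m, sv (A n) m ≤ τ m) (hB : ∀ m, sv B m ≤ τ m)
    (hw : ∀ x y : H, Tendsto (fun n => ⟪x, A n y⟫_ℂ) atTop (nhds ⟪x, B y⟫_ℂ)) :
    Tendsto (fun n => traceAlong b (C * A n)) atTop (nhds (traceAlong b (C * B))) := by
  have hτ0 : ∀ m, 0 ≤ τ m := fun m => (sv_nonneg _ _).trans (hB m)
  have hdiv : ∀ (n k : ℕ), n / k ≤ n := fun n k => Nat.div_le_self n k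
  let c : ℕ → ℝ := fun N => (1 / 2) ^ N / (1 + τ 0)
  have hτ1 : 0 < 1 + τ 0 := by have := hτ0 0; linarith
  have hc0 : ∀ N, 0 < c N := fun N => by simp only [c]; positivity
  have hcanti : ∀ {m n : ℕ}, m ≤ n → c n ≤ c m := fun {m n} h => by
    simp only [c]
    gcongr ?_ / _
    exact pow_le_pow_of_le_one (by norm_num) (by norm_num) h
  have hclim : Tendsto c atTop (nhds 0) := by
    have := (tendsto_pow_atTop_nhds_zero_of_lt_one (r := (1 / 2 : ℝ)) (by norm_num)
      (by norm_num)).div_const (1 + τ 0)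
    rwa [zero_div] at this
  choose F hF hFn using fun N : ℕ => sv_approx C N (hc0 N)
  have hbound : ∀ N m, sv (C - F N) m ≤ sv C (m / 2) + c (m / 2) := by
    intro N m
    rcases le_or_gt (2 * N) m with h | h
    · have h1 := sv_sub C (F N) (m - N) N (hF N)
      rw [Nat.sub_add_cancel (by omega)] at h1
      have h2 := sv_anti C (show m / 2 ≤ m - N by omega)
      have := hc0 (m / 2)
      linarith
    · have h1 := sv_le_norm (C - F N) m
      have h2 := hFn N
      have h3 := sv_anti C (show m / 2 ≤ N by omega)
      have h4 := hcanti (show m / 2 ≤ N by omega)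
      linarith
  let h : ℕ → ℝ := fun k => sv C k * τ k + (1 / 2) ^ k
  have hh0 : ∀ k, 0 ≤ h k := fun k => by
    have := sv_nonneg C k
    have := hτ0 k
    simp only [h]; positivity
  have hhs : Summable h := hs.add (summable_geometric_of_lt_one (by norm_num) (by norm_num))
  have hdom : ∀ N n, sv (C - F N) (n / 2) * τ (n / 2) ≤ h (n / 4) := by
    intro N n
    have h1 := hbound N (n / 2)
    have e : n / 2 / 2 = n / 4 := by omega
    rw [e] at h1
    have h2 : τ (n / 2) ≤ τ (n / 4) := hτ (by omega)
    have h3 : τ (n / 4) ≤ τ 0 := hτ (by omega)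
    have h4 := hτ0 (n / 2)
    have h5 := sv_nonneg C (n / 4)
    have h6 := hc0 (n / 4)
    have h7 : c (n / 4) * (1 + τ 0) = (1 / 2) ^ (n / 4) := by
      simp only [c]; field_simp
    have h8 := sv_nonneg (C - F N) (n / 2)
    calc sv (C - F N) (n / 2) * τ (n / 2) ≤ (sv C (n / 4) + c (n / 4)) * τ (n / 4) := by
          gcongr
      _ = sv C (n / 4) * τ (n / 4) + c (n / 4) * τ (n / 4) := by ring
      _ ≤ sv C (n / 4) * τ (n / 4) + c (n / 4) * (1 + τ 0) := by
          gcongr; linarith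
      _ = h (n / 4) := by rw [h7]
  have hhs4 : Summable fun n => h (n / 4) := summable_div hh0 hhs 4 (by norm_num)
  have hpos : ∀ N n, 0 ≤ sv (C - F N) (n / 2) * τ (n / 2) := fun N n =>
    mul_nonneg (sv_nonneg _ _) (hτ0 _)
  have hgs : ∀ N, Summable fun n => sv (C - F N) (n / 2) * τ (n / 2) := fun N =>
    Summable.of_nonneg_of_le (hpos N) (hdom N) hhs4
  let g : ℕ → ℝ := fun N => ∑' n, sv (C - F N) (n / 2) * τ (n / 2)
  have hg : Tendsto g atTop (nhds 0) := by
    have h1 := tendsto_tsum_of_dominated_convergence (𝓕 := atTop)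
      (f := fun N n => sv (C - F N) (n / 2) * τ (n / 2)) (g := fun _ => (0 : ℝ)) hhs4
      (fun n => by
        have hz : Tendsto (fun N => sv (C - F N) (n / 2)) atTop (nhds 0) := by
          refine squeeze_zero (fun N => sv_nonneg _ _)
            (fun N => (sv_le_norm _ _).trans (hFn N).le) ?_
          simpa using hC.add hclim
        simpa using hz.mul_const (τ (n / 2)))
      (Eventually.of_forall fun N n => by
        rw [Real.norm_of_nonneg (hpos N n)]; exact hdom N n)
    simpa using h1
  -- the trace error
  have herr : ∀ N (X : H →L[ℂ] H), (∀ m, sv X m ≤ τ m) →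
      ‖traceAlong b (C * X) - traceAlong b (F N * X)‖ ≤ 12 * g N := by
    intro N X hX
    have h1 := diag_summable b.orthonormal ((C - F N) * X) _ (hgs N) (fun n =>
      (sv_prod_le _ _ n).trans (mul_le_mul_of_nonneg_left (hX _) (sv_nonneg _ _)))
    obtain ⟨u, v, huv⟩ := (hF N).exists'
    have h2 : Summable fun i => ⟪b i, (F N * X) (b i)⟫_ℂ := by
      rw [huv]; exact (trace_FR b u v X).summable
    have h3 : traceAlong b (C * X)
        = (∑' i, ⟪b i, ((C - F N) * X) (b i)⟫_ℂ) + traceAlong b (F N * X) := by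
      unfold traceAlong
      rw [← h1.1.tsum_add h2]
      refine tsum_congr fun i => ?_
      rw [← inner_add_right, ← add_apply, ← add_mul, sub_add_cancel]
    rw [h3, add_sub_cancel_right]
    exact h1.2
  have hfin : ∀ N, Tendsto (fun n => traceAlong b (F N * A n)) atTop
      (nhds (traceAlong b (F N * B))) := by
    intro N
    obtain ⟨u, v, huv⟩ := (hF N).exists'
    have h1 : ∀ X, traceAlong b (F N * X) = ∑ j, ⟪u j, X (v j)⟫_ℂ := fun X => by
      rw [huv]; exact (trace_FR b u v X).tsum_eq
    simp only [h1]
    exact tendsto_finsetSum _ fun j _ => hw _ _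
  rw [Metric.tendsto_atTop]
  intro ε hε
  have h12 : Tendsto (fun N => 12 * g N) atTop (nhds 0) := by simpa using hg.const_mul 12
  obtain ⟨N, hN⟩ := (h12.eventually_lt_const (show 0 < ε / 3 by positivity)).exists
  obtain ⟨n0, hn0⟩ := Metric.tendsto_atTop.1 (hfin N) (ε / 3) (by positivity)
  refine ⟨n0, fun n hn => ?_⟩
  have e1 := herr N (A n) (hA n)
  have e2 := herr N B hB
  have e3 := hn0 n hn
  rw [dist_eq_norm] at *
  rw [norm_sub_rev] at e2
  have e4 : traceAlong b (C * A n) - traceAlong b (C * B)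
      = (traceAlong b (C * A n) - traceAlong b (F N * A n))
        + (traceAlong b (F N * A n) - traceAlong b (F N * B))
        + (traceAlong b (F N * B) - traceAlong b (C * B)) := by ring
  rw [e4]
  refine (norm_add₃_le).trans_lt ?_
  linarith

lemma rankOne_mul (f g f' g' : H) : rankOne f g * rankOne f' g' = ⟪f, g'⟫_ℂ • rankOne f' g := by
  ext x
  simp [rankOne_apply, inner_smul_right, smul_smul, mul_comm]

lemma rankOne_star (f g : H) : star (rankOne f g) = rankOne g f := by
  rw [ContinuousLinearMap.star_eq_adjoint]
  symm
  rw [ContinuousLinearMap.eq_adjoint_iff]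
  intro x y
  simp [rankOne_apply, inner_smul_left, inner_smul_right, mul_comm]

/-- partial swap -/
noncomputable def swp (b : HilbertBasis ℕ ℂ H) (n : ℕ) : H →L[ℂ] H :=
  1 - ∑ i ∈ Finset.range n, rankOne (b i - b (n + i)) (b i - b (n + i))

lemma b_inner (b : HilbertBasis ℕ ℂ H) (i j : ℕ) :
    ⟪b i, b j⟫_ℂ = if i = j then 1 else 0 :=
  orthonormal_iff_ite.1 b.orthonormal i j

lemma swp_star (b : HilbertBasis ℕ ℂ H) (n : ℕ) : star (swp b n) = swp b n := by
  simp [swp, rankOne_star]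

lemma swp_sq (b : HilbertBasis ℕ ℂ H) (n : ℕ) : swp b n * swp b n = 1 := by
  set Q := ∑ i ∈ Finset.range n, rankOne (b i - b (n + i)) (b i - b (n + i)) with hQ
  have h : Q * Q = 2 * Q := by
    rw [hQ, Finset.sum_mul_sum, Finset.mul_sum]
    refine Finset.sum_congr rfl fun i hi => ?_
    rw [Finset.sum_eq_single i]
    · rw [rankOne_mul]
      have : n ≠ 0 := by rintro rfl; simp at hi
      have e : ⟪b i - b (n + i), b i - b (n + i)⟫_ℂ = 2 := by
        simp only [inner_sub_left, inner_sub_right, b_inner]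
        simp [this]; norm_num
      rw [e, two_smul, two_mul]
    · intro j hj hji
      rw [rankOne_mul]
      have e : ⟪b i - b (n + i), b j - b (n + j)⟫_ℂ = 0 := by
        simp only [inner_sub_left, inner_sub_right, b_inner]
        rw [Finset.mem_range] at hi hj
        rw [if_neg (by omega), if_neg (by omega), if_neg (by omega), if_neg (by omega)]
        simp
      rw [e, zero_smul]
    · intro h; exact absurd hi h
  have : swp b n * swp b n = 1 - 2 * Q + Q * Q := by
    simp only [swp, ← hQ]; noncomm_ring
  rw [this, h]; simp

lemma swp_basis (b : HilbertBasis ℕ ℂ H) {n i j : ℕ} (hi : i < n) (hj : j < n) :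
    ⟪b i, swp b n (b j)⟫_ℂ = 0 := by
  have e : ∀ k ∈ Finset.range n, ⟪b i, rankOne (b k - b (n + k)) (b k - b (n + k)) (b j)⟫_ℂ
      = if k = i then (if i = j then 1 else 0) else 0 := by
    intro k hk
    rw [Finset.mem_range] at hk
    simp only [rankOne_apply, inner_smul_right, inner_sub_left, inner_sub_right, b_inner]
    rw [if_neg (show ¬ n + k = j by omega), if_neg (show ¬ i = n + k by omega)]
    by_cases h : k = i
    · subst h; simp
    · rw [if_neg (Ne.symm h), if_neg h]; simp
  simp only [swp, sub_apply, sum_apply, inner_sub_right, inner_sum]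
  rw [Finset.sum_congr rfl e]
  simp [b_inner, hi]

lemma swp_mem (b : HilbertBasis ℕ ℂ H) (n : ℕ) : swp b n ∈ unitary (H →L[ℂ] H) := by
  rw [Unitary.mem_iff, swp_star, swp_sq]; simp

lemma unitary_norm_le {V : H →L[ℂ] H} (hV : V ∈ unitary (H →L[ℂ] H)) : ‖V‖ ≤ 1 := by
  have h := CStarRing.norm_star_mul_self (x := V)
  rw [Unitary.star_mul_self_of_mem hV] at h
  have h2 : ‖(1 : H →L[ℂ] H)‖ ≤ 1 := ContinuousLinearMap.norm_id_le
  nlinarith [norm_nonneg V]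

lemma swp_weak (b : HilbertBasis ℕ ℂ H) (x y : H) :
    Tendsto (fun n => ⟪x, swp b n y⟫_ℂ) atTop (nhds 0) := by
  let P : H → ℕ → H := fun z n => ∑ i ∈ Finset.range n, b.repr z i • b i
  have hP : ∀ z, Tendsto (fun n => ‖z - P z n‖) atTop (nhds 0) := by
    intro z
    have h1 := (b.hasSum_repr z).tendsto_sum_nat
    have h2 := (tendsto_const_nhds (x := z)).sub h1
    simpa using h2.norm
  have hS : ∀ n z, ‖swp b n z‖ ≤ ‖z‖ := fun n z => by
    have := (swp b n).le_of_opNorm_le (unitary_norm_le (swp_mem b n)) z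
    simpa using this
  have h0 : ∀ n, ⟪P x n, swp b n (P y n)⟫_ℂ = 0 := by
    intro n
    simp only [P, map_sum, sum_inner, inner_sum, map_smul, inner_smul_left, inner_smul_right]
    refine Finset.sum_eq_zero fun i hi => ?_
    rw [Finset.sum_eq_zero fun j hj => ?_, mul_zero]
    rw [swp_basis b (Finset.mem_range.1 hj) (Finset.mem_range.1 hi), mul_zero]
  have hb : ∀ n, ‖⟪x, swp b n y⟫_ℂ‖ ≤ ‖x - P x n‖ * ‖y‖ + (‖x‖ + ‖x - P x n‖) * ‖y - P y n‖ := by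
    intro n
    have e : ⟪x, swp b n y⟫_ℂ = ⟪x - P x n, swp b n y⟫_ℂ + ⟪P x n, swp b n (y - P y n)⟫_ℂ := by
      rw [map_sub, inner_sub_right, h0, inner_sub_left]; ring
    rw [e]
    refine (norm_add_le _ _).trans (add_le_add ?_ ?_)
    · refine (norm_inner_le_norm _ _).trans ?_
      gcongr; exact hS n y
    · refine (norm_inner_le_norm _ _).trans ?_
      gcongr
      · have := norm_sub_le x (x - P x n)
        simpa using this
      · exact hS n _
  refine squeeze_zero_norm hb ?_
  have := ((hP x).mul_const ‖y‖).add (((hP x).const_add ‖x‖).mul (hP y))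
  simpa using this

lemma swp_compact (b : HilbertBasis ℕ ℂ H) {T : H →L[ℂ] H} (hT : IsCompactOperator T) (x y : H) :
    Tendsto (fun n => ⟪swp b n x, T (swp b n y)⟫_ℂ) atTop (nhds 0) := by
  have hS : ∀ n z, ‖swp b n z‖ ≤ ‖z‖ := fun n z => by
    have := (swp b n).le_of_opNorm_le (unitary_norm_le (swp_mem b n)) z
    simpa using this
  have hw : ∀ z w, Tendsto (fun n => ⟪swp b n z, w⟫_ℂ) atTop (nhds 0) := by
    intro z w
    have := (swp_weak b z w)
    refine this.congr fun n => ?_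
    conv_rhs => rw [← swp_star, ContinuousLinearMap.star_eq_adjoint,
      ContinuousLinearMap.adjoint_inner_left]
  rw [Metric.tendsto_atTop]
  intro ε hε
  obtain ⟨δ, hδ0, hδ⟩ : ∃ δ : ℝ, 0 < δ ∧ ‖x‖ * (δ * ‖y‖) < ε / 2 := by
    refine ⟨ε / 2 / (‖x‖ * ‖y‖ + 1), by positivity, ?_⟩
    have : ‖x‖ * (ε / 2 / (‖x‖ * ‖y‖ + 1) * ‖y‖) = ε / 2 * (‖x‖ * ‖y‖ / (‖x‖ * ‖y‖ + 1)) := by ring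
    rw [this]
    refine mul_lt_of_lt_one_right (by positivity) ?_
    rw [div_lt_one (by positivity)]; linarith
  obtain ⟨N, hN⟩ := ((sv_compact hT).eventually_lt_const (half_pos hδ0)).exists
  obtain ⟨F, hF, hFn⟩ := sv_approx T N (half_pos hδ0)
  obtain ⟨u, v, huv⟩ := hF.exists'
  have h1 : Tendsto (fun n => ⟪swp b n x, F (swp b n y)⟫_ℂ) atTop (nhds 0) := by
    have h2 : ∀ n, ⟪swp b n x, F (swp b n y)⟫_ℂ
        = ∑ j, ⟪u j, swp b n y⟫_ℂ * ⟪swp b n x, v j⟫_ℂ := fun n => by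
      rw [huv]; simp [rankOne_apply, inner_sum, inner_smul_right]
    simp only [h2]
    have := tendsto_finsetSum (Finset.univ : Finset (Fin N))
      (fun j _ => (swp_weak b (u j) y).mul (hw x (v j)))
    simpa using this
  obtain ⟨n0, hn0⟩ := Metric.tendsto_atTop.1 h1 (ε / 2) (by positivity)
  refine ⟨n0, fun n hn => ?_⟩
  have h3 := hn0 n hn
  rw [dist_zero_right] at *
  have e : ⟪swp b n x, T (swp b n y)⟫_ℂ
      = ⟪swp b n x, (T - F) (swp b n y)⟫_ℂ + ⟪swp b n x, F (swp b n y)⟫_ℂ := by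
    rw [sub_apply, inner_sub_right]; ring
  have h4 : ‖⟪swp b n x, (T - F) (swp b n y)⟫_ℂ‖ ≤ ‖x‖ * (δ * ‖y‖) := by
    refine (norm_inner_le_norm _ _).trans ?_
    have h5 := (T - F).le_of_opNorm_le (show ‖T - F‖ ≤ δ by linarith) (swp b n y)
    have h6 := hS n x
    have h7 := hS n y
    have h8 : δ * ‖swp b n y‖ ≤ δ * ‖y‖ := by gcongr
    exact mul_le_mul h6 (h5.trans h8) (norm_nonneg _) (norm_nonneg _)
  rw [e]
  refine (norm_add_le _ _).trans_lt ?_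
  linarith

/-- the interpolating unitaries -/
noncomputable def itp (b : HilbertBasis ℕ ℂ H) (t : ℝ) (n : ℕ) : H →L[ℂ] H :=
  ((√t : ℝ) : ℂ) • 1 + (((√(1 - t) : ℝ) : ℂ) * Complex.I) • swp b n

lemma itp_mem (b : HilbertBasis ℕ ℂ H) {t : ℝ} (h0 : 0 ≤ t) (h1 : t ≤ 1) (n : ℕ) :
    itp b t n ∈ unitary (H →L[ℂ] H) := by
  have ha : ((√t : ℝ) : ℂ) * ((√t : ℝ) : ℂ) = (t : ℂ) := by
    rw [← Complex.ofReal_mul, Real.mul_self_sqrt h0]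
  have hb : ((√(1 - t) : ℝ) : ℂ) * ((√(1 - t) : ℝ) : ℂ) = 1 - (t : ℂ) := by
    rw [← Complex.ofReal_mul, Real.mul_self_sqrt (by linarith)]; push_cast; ring
  unfold itp
  set α : ℂ := ((√t : ℝ) : ℂ) with hα
  set β : ℂ := ((√(1 - t) : ℝ) : ℂ) with hβ
  have hs : star (α • (1 : H →L[ℂ] H) + (β * Complex.I) • swp b n)
      = α • 1 - (β * Complex.I) • swp b n := by
    rw [star_add, star_smul, star_smul, swp_star, star_one, sub_eq_add_neg, ← neg_smul]
    congr 2
    · simp [hα]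
    · simp [hβ]
  have hI : β * Complex.I * (β * Complex.I) = (t : ℂ) - 1 := by
    have : β * Complex.I * (β * Complex.I) = β * β * (Complex.I * Complex.I) := by ring
    rw [this, hb, Complex.I_mul_I]; ring
  rw [Unitary.mem_iff, hs]
  constructor
  · simp only [mul_add, sub_mul, smul_mul_smul_comm, one_mul, mul_one, swp_sq, ha, hI]
    rw [mul_comm (β * Complex.I) α]
    module
  · simp only [mul_sub, add_mul, smul_mul_smul_comm, one_mul, mul_one, swp_sq, ha, hI]
    rw [mul_comm (β * Complex.I) α]
    module

lemma itp_weak (b : HilbertBasis ℕ ℂ H) {t : ℝ} (h0 : 0 ≤ t) {T : H →L[ℂ] H}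
    (hT : IsCompactOperator T) (x y : H) :
    Tendsto (fun n => ⟪x, (star (itp b t n) * T * itp b t n) y⟫_ℂ) atTop
      (nhds ⟪x, ((t : ℂ) • T) y⟫_ℂ) := by
  have ha : ((√t : ℝ) : ℂ) * ((√t : ℝ) : ℂ) = (t : ℂ) := by
    rw [← Complex.ofReal_mul, Real.mul_self_sqrt h0]
  have hw : ∀ z w, Tendsto (fun n => ⟪swp b n z, w⟫_ℂ) atTop (nhds 0) := by
    intro z w
    have := (swp_weak b z w)
    refine this.congr fun n => ?_
    conv_rhs => rw [← swp_star, ContinuousLinearMap.star_eq_adjoint,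
      ContinuousLinearMap.adjoint_inner_left]
  set α : ℂ := ((√t : ℝ) : ℂ) with hα
  set γ : ℂ := ((√(1 - t) : ℝ) : ℂ) * Complex.I with hγ
  have e : ∀ n, ⟪x, (star (itp b t n) * T * itp b t n) y⟫_ℂ =
      (t : ℂ) * ⟪x, T y⟫_ℂ + α * γ * ⟪ContinuousLinearMap.adjoint T x, swp b n y⟫_ℂ
      + (starRingEnd ℂ γ) * α * ⟪swp b n x, T y⟫_ℂ
      + (starRingEnd ℂ γ) * γ * ⟪swp b n x, T (swp b n y)⟫_ℂ := by
    intro n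
    have hαs : (starRingEnd ℂ) α = α := by rw [hα]; exact Complex.conj_ofReal _
    change ⟪x, star (itp b t n) (T (itp b t n y))⟫_ℂ = _
    rw [ContinuousLinearMap.star_eq_adjoint, ContinuousLinearMap.adjoint_inner_right,
      ContinuousLinearMap.adjoint_inner_left, ← ha]
    have hv : ∀ z, itp b t n z = α • z + γ • swp b n z := fun z => rfl
    simp only [hv, map_add, map_smul, inner_add_left, inner_add_right, inner_smul_left,
      inner_smul_right, hαs]
    ring
  simp only [e]
  have := ((tendsto_const_nhds (x := (t : ℂ) * ⟪x, T y⟫_ℂ)).add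
    ((swp_weak b (ContinuousLinearMap.adjoint T x) y).const_mul (α * γ))).add
    ((hw x (T y)).const_mul ((starRingEnd ℂ γ) * α)) |>.add
    ((swp_compact b hT x y).const_mul ((starRingEnd ℂ γ) * γ))
  simpa [inner_smul_right] using this

lemma holder_sv {p q : ℝ≥0∞} (hpq : 1 / p + 1 / q = 1) {C T : H →L[ℂ] H}
    (hC : MemSchatten p C) (hT : MemSchatten q T) : Summable fun n => sv C n * sv T n := by
  rcases eq_or_ne p ∞ with rfl | hp
  · have hq : q = 1 := by simpa using hpq
    subst hq
    have h := hT.2 (by simp)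
    simp only [ENNReal.toReal_one, Real.rpow_one] at h
    exact Summable.of_nonneg_of_le (fun n => mul_nonneg (sv_nonneg _ _) (sv_nonneg _ _))
      (fun n => mul_le_mul_of_nonneg_right (sv_le_norm C n) (sv_nonneg _ _)) (h.mul_left ‖C‖)
  rcases eq_or_ne q ∞ with rfl | hq
  · have hp : p = 1 := by simpa using hpq
    subst hp
    have h := hC.2 (by simp)
    simp only [ENNReal.toReal_one, Real.rpow_one] at h
    exact Summable.of_nonneg_of_le (fun n => mul_nonneg (sv_nonneg _ _) (sv_nonneg _ _))
      (fun n => mul_le_mul_of_nonneg_left (sv_le_norm T n) (sv_nonneg _ _)) (h.mul_right ‖T‖)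
  have hp0 : p ≠ 0 := by rintro rfl; simp at hpq
  have hq0 : q ≠ 0 := by rintro rfl; simp at hpq
  have hr : p.toReal⁻¹ + q.toReal⁻¹ = 1 := by
    have := congrArg ENNReal.toReal hpq
    rw [ENNReal.toReal_add (by simp [hp0]) (by simp [hq0])] at this
    simpa using this
  have hconj : p.toReal.HolderConjugate q.toReal := by
    have hp' : 0 < p.toReal := ENNReal.toReal_pos hp0 hp
    have hq' : 0 < q.toReal := ENNReal.toReal_pos hq0 hq
    exact ⟨by simpa using hr, hp', hq'⟩
  exact Real.summable_mul_of_Lp_Lq_of_nonneg hconj (sv_nonneg C) (sv_nonneg T) (hC.2 hp) (hT.2 hq)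

lemma smul_closure (b : HilbertBasis ℕ ℂ H) {p q : ℝ≥0∞} (hpq : 1 / p + 1 / q = 1)
    {C T : H →L[ℂ] H} (hC : MemSchatten p C) (hT : MemSchatten q T) {t : ℝ} (h0 : 0 ≤ t)
    (h1 : t ≤ 1) {w : ℂ} (hw : w ∈ cNumRange b C T) : t • w ∈ closure (cNumRange b C T) := by
  obtain ⟨U, hU, rfl⟩ := hw
  have hUs : ‖star U‖ ≤ 1 := by rw [norm_star]; exact unitary_norm_le hU
  have hcT : IsCompactOperator (star U * T * U) :=
    (hT.1.clm_comp (star U)).comp_clm U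
  have hsv : ∀ m, sv (star U * T * U) m ≤ sv T m := sv_contr _ _ _ hUs (unitary_norm_le hU)
  have key := trace_tendsto b C (sv T) (sv_anti T) (holder_sv hpq hC hT) (sv_compact hC.1)
    (fun n => star (itp b t n) * (star U * T * U) * itp b t n) ((t : ℂ) • (star U * T * U))
    (fun n m => by
      have hV := unitary_norm_le (itp_mem b h0 h1 n)
      exact (sv_contr _ _ _ (by rw [norm_star]; exact hV) hV m).trans (hsv m))
    (fun m => by
      have := sv_contr ((t : ℂ) • (1 : H →L[ℂ] H)) (star U * T * U) 1 (by
        rw [norm_smul, Complex.norm_real, Real.norm_of_nonneg h0]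
        exact mul_le_one₀ h1 (norm_nonneg _) ContinuousLinearMap.norm_id_le)
        ContinuousLinearMap.norm_id_le m
      rw [smul_mul_assoc, one_mul, mul_one] at this
      exact this.trans (hsv m))
    (fun x y => itp_weak b h0 hcT x y)
  have e : traceAlong b (C * ((t : ℂ) • (star U * T * U))) = t • traceAlong b (C * star U * T * U) := by
    unfold traceAlong
    rw [Complex.real_smul, ← tsum_mul_left]
    refine tsum_congr fun i => ?_
    rw [mul_smul_comm, smul_apply, inner_smul_right]
    simp only [mul_assoc]
  rw [e] at key
  refine mem_closure_of_tendsto key (Eventually.of_forall fun n => ?_)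
  refine ⟨U * itp b t n, mul_mem hU (itp_mem b h0 h1 n), ?_⟩
  rw [star_mul]
  simp only [mul_assoc]

end helpers

/-- For conjugate `p, q ∈ [1,∞]`, `C ∈ B^p(H)` and `T ∈ B^q(H)`, the closure
of the `C`-numerical range `W_C(T)` is star-shaped with respect to the origin. -/
theorem stmt_11 {H : Type*} [NormedAddCommGroup H] [InnerProductSpace ℂ H] [CompleteSpace H]
    (b : HilbertBasis ℕ ℂ H)  -- `H` is infinite-dimensional and separable
    (p q : ℝ≥0∞) (hpq : 1 / p + 1 / q = 1)
    (C T : H →L[ℂ] H) (hC : MemSchatten p C) (hT : MemSchatten q T) :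
    (0 : ℂ) ∈ closure (cNumRange b C T) ∧
      StarConvex ℝ (0 : ℂ) (closure (cNumRange b C T)) := by
  have hstar : StarConvex ℝ (0 : ℂ) (closure (cNumRange b C T)) := by
    rw [starConvex_zero_iff]
    intro w hw t h0 h1
    have hm : Set.MapsTo (fun z : ℂ => t • z) (cNumRange b C T) (closure (cNumRange b C T)) :=
      fun z hz => smul_closure b hpq hC hT h0 h1 hz
    have := hm.closure (continuous_const_smul t) hw
    rwa [closure_closure] at this
  refine ⟨?_, hstar⟩
  have h := smul_closure b hpq hC hT le_rfl zero_le_one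
    (w := traceAlong b (C * star 1 * T * 1)) ⟨1, one_mem _, rfl⟩
  simpa using h
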